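/- For each n ∈ ω let β_n ∈ ω^ω be given by β_n(i) := i + n, and set B_n := A^{S_{β_n}}. Then for every n ∈ ω, B_{n+1} ≤ʳ_c B_n and B_n ≰ʳ_c B_{n+1}. In particular, the quasi-order ≤ʳ_c on D₂(Σ⁰₁) ∖ pot(Π⁰₁) sets is not well-founded. -/

import Mathlib

open Set Topology

abbrev Cantor : Type := ℕ → Bool

/-- `A ⊆ X × Y` is potentially closed (`pot(Π⁰₁)`): there are finer Polish topologies on `X`
and `Y` making `A` closed in the product. -/
def PotClosed {X Y : Type} (tX : TopologicalSpace X) (tY : TopologicalSpace Y)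
    (A : Set (X × Y)) : Prop :=
  ∃ (σ : TopologicalSpace X) (τ : TopologicalSpace Y),
    σ ≤ tX ∧ τ ≤ tY ∧ @PolishSpace X σ ∧ @PolishSpace Y τ ∧
    @IsClosed (X × Y) (@instTopologicalSpaceProd X Y σ τ) A

/-- Membership in the class `D₂(Σ⁰₁)`: difference of two open sets. -/
def D2Sigma01 {Z : Type} (t : TopologicalSpace Z) (A : Set Z) : Prop :=
  ∃ U V : Set Z, @IsOpen Z t U ∧ @IsOpen Z t V ∧ A = U \ V

/-- The rectangular continuous reducibility `A ≤ʳ_c A'`. -/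
def RedRC {X Y X' Y' : Type} (tX : TopologicalSpace X) (tY : TopologicalSpace Y)
    (tX' : TopologicalSpace X') (tY' : TopologicalSpace Y')
    (A : Set (X × Y)) (A' : Set (X' × Y')) : Prop :=
  ∃ (u : X → X') (v : Y → Y'),
    @Continuous X X' tX tX' u ∧ @Continuous Y Y' tY tY' v ∧
    A = (fun p => (u p.1, v p.2)) ⁻¹' A'

/-- `≤ʳ_c` on subsets of `Cantor × Cantor` with the standard topology. -/
def RedC2 (A A' : Set (Cantor × Cantor)) : Prop :=
  RedRC inferInstance inferInstance inferInstance inferInstance A A'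

/-- `A` is `≤ʳ_c`-minimal among non-potentially closed Borel sets. -/
def MinNonPotClosed {X Y : Type} (tX : TopologicalSpace X) (tY : TopologicalSpace Y)
    (A : Set (X × Y)) : Prop :=
  ¬ PotClosed tX tY A ∧
  ∀ (X' Y' : Type) (tX' : TopologicalSpace X') (tY' : TopologicalSpace Y'),
    @PolishSpace X' tX' → @PolishSpace Y' tY' →
    ∀ A' : Set (X' × Y'),
      @MeasurableSet (X' × Y') (@borel (X' × Y') (@instTopologicalSpaceProd X' Y' tX' tY')) A' →
      ¬ PotClosed tX' tY' A' →
      RedRC tX' tY' tX tY A' A → RedRC tX tY tX' tY' A A'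

/-- The Borel reducibility `A ≤_B A'` for square sets. -/
def RedB {Z Z' : Type} (tZ : TopologicalSpace Z) (tZ' : TopologicalSpace Z')
    (A : Set (Z × Z)) (A' : Set (Z' × Z'))  : Prop :=
  ∃ u : Z → Z', @Measurable Z Z' (@borel Z tZ) (@borel Z' tZ') u ∧
    A = (fun p => (u p.1, u p.2)) ⁻¹' A'

/-- `A` is `≤_B`-minimal among non-potentially closed Borel (square) sets. -/
def MinBNonPotClosed {Z : Type} (tZ : TopologicalSpace Z) (A : Set (Z × Z)) : Prop :=
  ¬ PotClosed tZ tZ A ∧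
  ∀ (Z' : Type) (tZ' : TopologicalSpace Z'), @PolishSpace Z' tZ' →
    ∀ A' : Set (Z' × Z'),
      @MeasurableSet (Z' × Z') (@borel (Z' × Z') (@instTopologicalSpaceProd Z' Z' tZ' tZ')) A' →
      ¬ PotClosed tZ' tZ' A' →
      RedB tZ' tZ A' A → RedB tZ tZ' A A'

/-- The graph of the partial function `f` with domain `D`. -/
def graphRel {X : Type} (D : Set X) (f : X → X) : Set (X × X) :=
  {p | p.1 ∈ D ∧ p.2 = f p.1}

/-- `A^f := ⋃ₙ Graph(fₙ)`. -/
def unionGraphs {X : Type} (D : ℕ → Set X) (f : ℕ → X → X) : Set (X × X) :=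
  ⋃ n, graphRel (D n) (f n)

/-- `f` restricted to `D` is a partial homeomorphism with clopen domain and clopen range. -/
def IsPartialHomeo {X : Type} (t : TopologicalSpace X) (D : Set X) (f : X → X) : Prop :=
  @IsClopen X t D ∧ @IsClopen X t (f '' D) ∧ @ContinuousOn X X t t f D ∧
    ∃ g : X → X, @ContinuousOn X X t t g (f '' D) ∧ ∀ x ∈ D, g (f x) = x

/-- A converging situation: a nonempty zero-dimensional perfect Polish space together with
partial homeomorphisms with clopen domains and ranges such that
`Δ(X) = closure(A^f) \ A^f`. -/
def ConvSit (X : Type) (t : TopologicalSpace X) (D : ℕ → Set X) (f : ℕ → X → X) : Prop :=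
  Nonempty X ∧ @PolishSpace X t ∧
  @TopologicalSpace.IsTopologicalBasis X t {s : Set X | @IsClopen X t s} ∧
  @Perfect X t Set.univ ∧
  (∀ n, IsPartialHomeo t (D n) (f n)) ∧
  Set.diagonal X =
    @closure (X × X) (@instTopologicalSpaceProd X X t t) (unionGraphs D f) \ unionGraphs D f

/-- The domain of the restriction `f^B` of the partial map `(D, f)` to a subset `B`. -/
def subD {X : Type} (B : Set X) (D : Set X) (f : X → X) : Set ↥B :=
  {x | (x : X) ∈ D ∧ f (x : X) ∈ B}

/-- The restriction `f^B` of `f` to `B`, as a map of the subtype (junk value outside). -/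
noncomputable def subF {X : Type} (B : Set X) (f : X → X) : ↥B → ↥B :=
  fun x =>
    letI := Classical.dec (f (x : X) ∈ B)
    if h : f (x : X) ∈ B then ⟨f (x : X), h⟩ else x

/-- `A^f ∩ B²`, viewed on the subtype `B`: the union of the graphs of the `f^B_n`'s. -/
def restrGraphs {X : Type} (B : Set X) (D : ℕ → Set X) (f : ℕ → X → X) : Set (↥B × ↥B) :=
  unionGraphs (fun n => subD B (D n) (f n)) (fun n => subF B (f n))

/-- The subspace topology on `B` induced by a topology `t` on `X`. -/
def subTop {X : Type} (t : TopologicalSpace X) (B : Set X) : TopologicalSpace ↥B :=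
  @TopologicalSpace.induced ↥B X Subtype.val t

/-- The natural bijection `ψ : ω → 2^{<ω}` (enumeration by length, then lexicographically):
`ψ(n)` is the binary expansion of `n+1` with its leading one removed. -/
def psiSeq (n : ℕ) : List Bool := ((n + 1).bits.dropLast).reverse

/-- `s_n := ψ(n)0^{n-|ψ(n)|}`, a dense sequence with `|s_n| = n`. -/
def sSeq (n : ℕ) : List Bool := psiSeq n ++ List.replicate (n - (psiSeq n).length) false

/-- The concatenation `sγ` of a finite sequence `s` with `γ ∈ 2^ω`. -/
def catSeq (s : List Bool) (γ : Cantor) : Cantor :=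
  fun i => if h : i < s.length then s.get ⟨i, h⟩ else γ (i - s.length)

/-- `A₁ := {(s_n0γ, s_n1γ) : n ∈ ω, γ ∈ 2^ω}`. -/
def A1 : Set (Cantor × Cantor) :=
  {p | ∃ (n : ℕ) (γ : Cantor),
    p.1 = catSeq (sSeq n ++ [false]) γ ∧ p.2 = catSeq (sSeq n ++ [true]) γ}

/-- `Card(x↾n)`: the number of ones among the first `n` coordinates of `x`. -/
def cardOnes (x : Cantor) (n : ℕ) : ℕ := ∑ i ∈ Finset.range n, (if x i then 1 else 0)

/-- The domain of `f^S_n`: sequences vanishing at `n` whose first `n` coordinates contain a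
number of ones belonging to `S`. -/
def DSdom (S : Set ℕ) (n : ℕ) : Set Cantor := {x | x n = false ∧ cardOnes x n ∈ S}

/-- `f^S_n (s0γ) := s1γ`: flip the `n`-th coordinate to one. -/
def fSfun (n : ℕ) : Cantor → Cantor := fun x => Function.update x n true

/-- `A^S := {(s0γ, s1γ) : s ∈ 2^{<ω}, Card(s) ∈ S, γ ∈ 2^ω} = ⋃ₙ Graph(f^S_n)`. -/
def ASet (S : Set ℕ) : Set (Cantor × Cantor) := unionGraphs (DSdom S) fSfun

/-- Condition (M) on `S ⊆ ω`. -/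
def CondM (S : Set ℕ) : Prop :=
  ∀ p : ℕ, ∃ k : ℕ, ∀ q : ℕ, ∃ c : ℕ, q ≤ c ∧ c ≤ q + k ∧
    (fun m => c + m) '' (S ∩ Set.Iic p) = S ∩ Set.Icc c (c + p)

/-- Condition (H) on `S ⊆ ω`. -/
def CondH (S : Set ℕ) : Prop :=
  ∀ C : Set Cantor, @MeasurableSet Cantor (borel Cantor) C →
    ∀ σ : TopologicalSpace ↥C, σ ≤ subTop inferInstance C →
      ConvSit ↥C σ (fun n => subD C (DSdom S n) (fSfun n)) (fun n => subF C (fSfun n)) →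
      ∀ l p : ℕ, ∃ n : ℕ, l ≤ n ∧ ∃ γ : ↥C, γ ∈ subD C (DSdom S n) (fSfun n) ∧
        (fun m => cardOnes (γ : Cantor) n + m) '' (S ∩ Set.Iic p) =
          S ∩ Set.Icc (cardOnes (γ : Cantor) n) (cardOnes (γ : Cantor) n + p)

/-- Condition (⊥) on a pair `(S, S')`. -/
def CondPerp (S S' : Set ℕ) : Prop :=
  ∃ p : ℕ, ∀ c : ℕ, (fun m => c + m) '' (S ∩ Set.Iic p) ≠ S' ∩ Set.Icc c (c + p)

/-- Condition (⊥⁻¹) on a pair `(S, S')` (stated in `ℤ` to handle subtraction). -/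
def CondPerpInv (S S' : Set ℕ) : Prop :=
  ∃ p : ℕ, ∀ c : ℕ,
    (fun m : ℕ => (c : ℤ) - (m : ℤ)) '' (S ∩ Set.Iic p) ≠
      ((fun n : ℕ => (n : ℤ)) '' S') ∩ Set.Icc ((c : ℤ) - (p : ℤ)) (c : ℤ)

/-- `A⁻¹ := {(y,x) : (x,y) ∈ A}`. -/
def invRel {X : Type} (A : Set (X × X)) : Set (X × X) := {p | (p.2, p.1) ∈ A}

/-- `γ_α`: `γ_α(4n+2ε) = ε` and `γ_α(2n+1) = α(n)`. -/
def gammaSeq (α : Cantor) (k : ℕ) : Bool :=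
  if k % 2 = 1 then α (k / 2) else decide (k % 4 = 2)

/-- `β_α(i) := γ_α((i)₀)` where `(i)₀ = max {m : 2^m ∣ i+1}`, with values in `{0,1} ⊆ ω`. -/
def betaSeq (α : Cantor) (i : ℕ) : ℕ :=
  if gammaSeq α ((i + 1).factorization 2) then 1 else 0

/-- `S_β := {Σ_{i<l} (1 + β(i)) : l ∈ ω}`. -/
def Sbeta (β : ℕ → ℕ) : Set ℕ :=
  {m | ∃ l : ℕ, m = ∑ i ∈ Finset.range l, (1 + β i)}

/-- `s_n` as a function `ℕ → Bool` (with junk value `false` beyond `n`). -/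
def sSeqFn (n : ℕ) (i : ℕ) : Bool := (sSeq n).getD i false

/-- The domain of `f¹_n` (direction `d = true`) or of `(f¹_n)⁻¹` (direction `d = false`):
`x` extends `s_n` and `x(n) = !d`. -/
def step1Dom (n : ℕ) (d : Bool) : Set Cantor :=
  {x | (∀ i, i < n → x i = sSeqFn n i) ∧ x n = !d}

/-- `f¹_n` (if `d = true`) or its inverse (if `d = false`): set the `n`-th coordinate to `d`. -/
def step1Fun (n : ℕ) (d : Bool) : Cantor → Cantor := fun x => Function.update x n d

/-- Domain of `fₙ` (direction `d = true`) or of `fₙ⁻¹` (direction `d = false`). -/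
def stepDom {X : Type} (D : ℕ → Set X) (f : ℕ → X → X) (n : ℕ) (d : Bool) : Set X :=
  if d then D n else f n '' D n

/-- `fₙ` (direction `d = true`) or its inverse `gₙ` (direction `d = false`). -/
def stepFun {X : Type} (f g : ℕ → X → X) (n : ℕ) (d : Bool) : X → X :=
  if d then f n else g n

/-- An acyclic situation (Definition 26), with `g n` the inverse of `f n`. -/
def AcyclicSit (X : Type) (t : TopologicalSpace X) (D : ℕ → Set X) (f g : ℕ → X → X) : Prop :=
  Nonempty X ∧ @PolishSpace X t ∧
  @TopologicalSpace.IsTopologicalBasis X t {s : Set X | @IsClopen X t s} ∧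
  @Perfect X t Set.univ ∧
  (∀ n, IsPartialHomeo t (D n) (f n)) ∧
  (∀ n, ∀ x ∈ D n, g n (f n x) = x) ∧
  Set.diagonal X ⊆
    @closure (X × X) (@instTopologicalSpaceProd X X t t) (unionGraphs D f) \ unionGraphs D f ∧
  (∀ m : ℕ, 1 ≤ m → ∀ (v : ℕ → ℕ) (ε : ℕ → Bool),
    (∀ i, i + 1 < m → v i ≠ v (i + 1) ∨ ε i = ε (i + 1)) →
    ∀ U : Set X, @IsClopen X t U → U.Nonempty →
      ∃ V : Set X, @IsClopen X t V ∧ V.Nonempty ∧ V ⊆ U ∧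
        ∀ x ∈ V, ∀ w : ℕ → X, w 0 = x →
          (∀ i, i < m → w i ∈ stepDom D f (v i) (ε i) ∧
            w (i + 1) = stepFun f g (v i) (ε i) (w i)) →
          w m ∉ V)

/-- The relation `ℜ_Θ` on `2^{<ω}`: `e ℜ_Θ e'` iff `e = e'` or
`(e, e') = (θ_n0w, θ_n1w)` for some `n` and `w`. -/
def RTheta (θ : ℕ → List Bool) (e e' : List Bool) : Prop :=
  e = e' ∨ ∃ (n : ℕ) (w : List Bool), e = θ n ++ false :: w ∧ e' = θ n ++ true :: w

/-- The symmetrization `s(ℜ_Θ)`. -/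
def sRTheta (θ : ℕ → List Bool) (e e' : List Bool) : Prop :=
  RTheta θ e e' ∨ RTheta θ e' e

lemma mem_ASet {S : Set ℕ} {x y : Cantor} :
    (x, y) ∈ ASet S ↔
      ∃ k, x k = false ∧ cardOnes x k ∈ S ∧ y = Function.update x k true := by
  simp [ASet, unionGraphs, graphRel, DSdom, fSfun, and_assoc]

lemma cardOnes_zero (x : Cantor) : cardOnes x 0 = 0 := by
  simp [cardOnes]

lemma cardOnes_succ (x : Cantor) (n : ℕ) :
    cardOnes x (n + 1) = cardOnes x n + (if x n then 1 else 0) :=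
  Finset.sum_range_succ _ _

lemma cardOnes_congr {x y : Cantor} {n : ℕ} (h : ∀ i < n, x i = y i) :
    cardOnes x n = cardOnes y n :=
  Finset.sum_congr rfl fun i hi => by rw [h i (Finset.mem_range.1 hi)]

lemma cardOnes_eq_zero {x : Cantor} {n : ℕ} (h : ∀ i < n, x i = false) : cardOnes x n = 0 :=
  Finset.sum_eq_zero fun i hi => by simp [h i (Finset.mem_range.1 hi)]

lemma cardOnes_add_of_true {x : Cantor} {M d : ℕ} (h : ∀ i, M ≤ i → i < M + d → x i = true) :
    cardOnes x (M + d) = cardOnes x M + d := by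
  induction d with
  | zero => rfl
  | succ d ih =>
    rw [← add_assoc, cardOnes_succ, ih fun i h₁ h₂ => h i h₁ (by omega),
      h (M + d) (by omega) (by omega)]
    simp [add_assoc]

lemma cardOnes_add_of_false {x : Cantor} {M d : ℕ} (h : ∀ i, M ≤ i → i < M + d → x i = false) :
    cardOnes x (M + d) = cardOnes x M := by
  induction d with
  | zero => rfl
  | succ d ih =>
    rw [← add_assoc, cardOnes_succ, ih fun i h₁ h₂ => h i h₁ (by omega),
      h (M + d) (by omega) (by omega)]
    simp

lemma cardOnes_update_true {x : Cantor} {k N : ℕ} (hx : x k = false) (hk : k < N) :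
    cardOnes (Function.update x k true) N = cardOnes x N + 1 := by
  have hk' : k ∈ Finset.range N := Finset.mem_range.2 hk
  unfold cardOnes
  rw [← Finset.add_sum_erase _ _ hk', ← Finset.add_sum_erase _ _ hk',
    Finset.sum_congr rfl (g := fun i => if x i = true then 1 else 0)]
  · simp [hx, add_comm]
  · intro i hi
    simp [Function.update_of_ne (Finset.ne_of_mem_erase hi)]

lemma continuous_cardOnes (n : ℕ) : Continuous fun x : Cantor => cardOnes x n :=
  continuous_finsetSum _ fun i _ =>
    (continuous_of_discreteTopology (f := fun b : Bool => if b then 1 else 0)).comp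
      (continuous_apply i)

lemma isClopen_DSdom (S : Set ℕ) (n : ℕ) : IsClopen (DSdom S n) :=
  ((isClopen_discrete {false}).preimage (continuous_apply n)).inter
    ((isClopen_discrete S).preimage (continuous_cardOnes n))

/-- Adding the diagonal to `A^S` gives a closed set. -/
lemma isClosed_ASet_union_diagonal (S : Set ℕ) :
    IsClosed (ASet S ∪ diagonal Cantor) := by
  have key : ASet S ∪ diagonal Cantor = ⋂ i : ℕ,
      {p : Cantor × Cantor | p.1 i = p.2 i} ∪
        {p | p.1 ∈ DSdom S i ∧ p.2 = Function.update p.1 i true} := by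
    ext ⟨x, y⟩
    simp only [mem_union, mem_ASet, mem_diagonal_iff, mem_iInter, mem_ofPred_eq, DSdom]
    constructor
    · rintro (⟨k, hk, hS, rfl⟩ | rfl) i
      · by_cases h : i = k
        · subst h
          exact Or.inr ⟨⟨hk, hS⟩, rfl⟩
        · exact Or.inl (by simp [h])
      · exact Or.inl rfl
    · intro h
      by_cases hxy : x = y
      · exact Or.inr hxy
      · obtain ⟨i, hi⟩ := Function.ne_iff.1 hxy
        obtain ⟨⟨h₁, h₂⟩, h₃⟩ := (h i).resolve_left hi
        exact Or.inl ⟨i, h₁, h₂, h₃⟩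
  rw [key]
  refine isClosed_iInter fun i => IsClosed.union ?_ (IsClosed.inter ?_ ?_)
  · exact isClosed_eq (by fun_prop) (by fun_prop)
  · exact (isClopen_DSdom S i).isClosed.preimage continuous_fst
  · exact isClosed_eq continuous_snd (continuous_fst.update i continuous_const)

lemma diagonal_notMem_ASet (S : Set ℕ) (x : Cantor) : (x, x) ∉ ASet S := by
  rw [mem_ASet]
  rintro ⟨k, hk, -, h⟩
  have := congrFun h k
  simp [hk] at this

lemma d2Sigma01_ASet (S : Set ℕ) : D2Sigma01 inferInstance (ASet S) := by
  refine ⟨(diagonal Cantor)ᶜ, (ASet S ∪ diagonal Cantor)ᶜ, isClosed_diagonal.isOpen_compl,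
    (isClosed_ASet_union_diagonal S).isOpen_compl, ?_⟩
  ext ⟨x, y⟩
  have := diagonal_notMem_ASet S x
  simp only [mem_sdiff, mem_compl_iff, mem_union, mem_diagonal_iff, not_not]
  constructor
  · intro h
    exact ⟨fun e => this (e ▸ h), Or.inl h⟩
  · rintro ⟨h₁, h₂⟩
    exact h₂.resolve_right h₁

lemma dense_iUnion_DSdom {S : Set ℕ} (hS : ∀ m, ∃ s ∈ S, m ≤ s) (N : ℕ) :
    Dense {x : Cantor | ∃ k, N ≤ k ∧ x ∈ DSdom S k} := by
  intro x
  choose s hsS hs using hS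
  let y : ℕ → Cantor := fun M i =>
    if i < M then x i else decide (i < M + (s (cardOnes x M) - cardOnes x M))
  refine mem_closure_of_tendsto (f := y) (b := Filter.atTop) ?_ ?_
  · rw [tendsto_pi_nhds]
    intro i
    refine tendsto_const_nhds.congr' ?_
    filter_upwards [Filter.eventually_gt_atTop i] with M hM
    simp [y, hM]
  · filter_upwards [Filter.eventually_ge_atTop N] with M hM
    refine ⟨M + (s (cardOnes x M) - cardOnes x M), by omega, by simp [y], ?_⟩
    have h₁ : cardOnes (y M) M = cardOnes x M := cardOnes_congr fun i hi => by simp [y, hi]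
    have h₂ := hs (cardOnes x M)
    have h₃ : cardOnes (y M) (M + (s (cardOnes x M) - cardOnes x M)) = s (cardOnes x M) := by
      rw [cardOnes_add_of_true, h₁]
      · omega
      · intro i hi hi'
        simp only [y]
        rw [if_neg (by omega)]
        simpa using hi'
    rw [h₃]
    exact hsS _

lemma residual_frequently_DSdom {S : Set ℕ} (hS : ∀ m, ∃ s ∈ S, m ≤ s) :
    ∀ᶠ x in residual Cantor, ∀ N, ∃ k, N ≤ k ∧ x ∈ DSdom S k := by
  rw [eventually_countable_forall]
  intro N
  refine residual_of_dense_open ?_ (dense_iUnion_DSdom hS N)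
  have : {x : Cantor | ∃ k, N ≤ k ∧ x ∈ DSdom S k} = ⋃ k, ⋃ _ : N ≤ k, DSdom S k := by
    ext; simp
  change IsOpen {x : Cantor | ∃ k, N ≤ k ∧ x ∈ DSdom S k}
  rw [this]
  exact isOpen_iUnion fun k => isOpen_iUnion fun _ => (isClopen_DSdom S k).isOpen

lemma tendsto_update (x : Cantor) (b : Bool) :
    Filter.Tendsto (fun k => Function.update x k b) Filter.atTop (𝓝 x) := by
  rw [tendsto_pi_nhds]
  intro i
  refine tendsto_const_nhds.congr' ?_
  filter_upwards [Filter.eventually_gt_atTop i] with k hk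
  rw [Function.update_of_ne hk.ne]

/-- Negation of the `k`-th coordinate. -/
def flipAt (k : ℕ) : Cantor ≃ₜ Cantor where
  toFun x := Function.update x k (!x k)
  invFun x := Function.update x k (!x k)
  left_inv x := by simp
  right_inv x := by simp
  continuous_toFun := continuous_id.update k
    ((continuous_of_discreteTopology (f := not)).comp (continuous_apply k))
  continuous_invFun := continuous_id.update k
    ((continuous_of_discreteTopology (f := not)).comp (continuous_apply k))

/-- A finer Polish topology agrees with the original one on a comeager set. -/
lemma exists_residual_tendsto_of_le {X : Type*} {τ : TopologicalSpace X} [t : TopologicalSpace X]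
    [PolishSpace X] (hle : τ ≤ t) (hτ : @PolishSpace X τ) :
    ∃ G ∈ residual X, ∀ x ∈ G, ∀ W, IsOpen[τ] W → x ∈ W → ∀ᶠ y in 𝓝 x, y ∈ G → y ∈ W := by
  have hsc : @SecondCountableTopology X τ := hτ.toSecondCountableTopology
  obtain ⟨B, hBc, -, hB⟩ := @TopologicalSpace.exists_countable_basis X τ hsc
  borelize X
  have hmeas : ∀ W ∈ B, MeasurableSet W := by
    intro W hW
    have h₁ : @MeasurableSet X (@borel X τ) W :=
      MeasurableSpace.measurableSet_generateFrom (@TopologicalSpace.IsTopologicalBasis.isOpen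
        X τ W B hB hW)
    rwa [MeasureTheory.borel_eq_borel_of_le hτ inferInstance hle,
      ← BorelSpace.measurable_eq (α := X)] at h₁
  choose! O hO hWO using fun W (hW : W ∈ B) => (hmeas W hW).residualEq_isOpen
  refine ⟨{x | ∀ W ∈ B, (x ∈ W ↔ x ∈ O W)}, ?_, ?_⟩
  · refine (eventually_countable_ball hBc).2 fun W hW => ?_
    filter_upwards [hWO W hW] with x hx
    exact iff_of_eq hx
  · intro x hx W hW hxW
    obtain ⟨V, hVB, hxV, hVW⟩ :=
      @TopologicalSpace.IsTopologicalBasis.exists_subset_of_mem_open X τ B hB x W hxW hW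
    filter_upwards [(hO V hVB).mem_nhds ((hx V hVB).1 hxV)] with y hy hyG
    exact hVW ((hyG V hVB).2 hy)

/-- Every comeager set contains some `x` together with infinitely many of its `A^S`-successors
obtained by switching on one coordinate. -/
lemma exists_frequently_update_mem {S : Set ℕ} (hS : ∀ m, ∃ s ∈ S, m ≤ s) {G : Set Cantor}
    (hG : G ∈ residual Cantor) :
    ∃ x ∈ G, ∃ᶠ k in Filter.atTop,
      Function.update x k true ∈ G ∧ (x, Function.update x k true) ∈ ASet S := by
  have hflip : ∀ᶠ x in residual Cantor, ∀ k, flipAt k x ∈ G :=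
    eventually_countable_forall.2 fun k =>
      tendsto_residual_of_isOpenMap (flipAt k).continuous (flipAt k).isOpenMap hG
  obtain ⟨x, hxG, hxflip, hx⟩ := (dense_of_mem_residual
    (Filter.inter_mem hG (hflip.and (residual_frequently_DSdom hS)))).nonempty
  refine ⟨x, hxG, Filter.frequently_atTop.2 fun N => ?_⟩
  obtain ⟨k, hk, hxk⟩ := hx N
  exact ⟨k, hk, by simpa [flipAt, hxk.1] using hxflip k, mem_ASet.2 ⟨k, hxk.1, hxk.2, rfl⟩⟩

lemma not_potClosed_ASet {S : Set ℕ} (hS : ∀ m, ∃ s ∈ S, m ≤ s) :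
    ¬ PotClosed inferInstance inferInstance (ASet S) := by
  have hP : PolishSpace Cantor := by
    let := TopologicalSpace.metrizableSpaceMetric Cantor
    infer_instance
  rintro ⟨σ, τ, -, hτle, -, hτ, hA⟩
  obtain ⟨G, hG, hGτ⟩ := @exists_residual_tendsto_of_le Cantor τ Pi.topologicalSpace
    hP hτle hτ
  obtain ⟨x, hxG, hx⟩ := exists_frequently_update_mem hS hG
  have hsec : IsOpen[τ] {y | (x, y) ∉ ASet S} :=
    @IsOpen.preimage _ _ τ (@instTopologicalSpaceProd _ _ σ τ) _
      (@Continuous.prodMk_right _ _ σ τ x) _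
      (@IsClosed.isOpen_compl _ (@instTopologicalSpaceProd _ _ σ τ) _ hA)
  have hev := (tendsto_update x true).eventually
    (hGτ x hxG _ hsec (diagonal_notMem_ASet S x))
  obtain ⟨k, ⟨hkG, hkA⟩, hk⟩ := (hx.and_eventually hev).exists
  exact hk hkG hkA

/-- The two components of a reduction between sets `A^S` coincide. -/
lemma reduction_components_eq {S S' : Set ℕ} (hS : ∀ m, ∃ s ∈ S, m ≤ s) {u v : Cantor → Cantor}
    (hu : Continuous u) (hv : Continuous v)
    (h : ∀ x y, (x, y) ∈ ASet S ↔ (u x, v y) ∈ ASet S') : u = v := by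
  refine hu.ext_on (dense_of_mem_residual (residual_frequently_DSdom hS)) hv fun x hx => ?_
  have hclosed : IsClosed {y | (u x, v y) ∈ ASet S' ∪ diagonal Cantor} :=
    (isClosed_ASet_union_diagonal S').preimage (by fun_prop)
  have hmem : (u x, v x) ∈ ASet S' ∪ diagonal Cantor := by
    refine hclosed.mem_of_frequently_of_tendsto ?_ (tendsto_update x true)
    refine Filter.frequently_atTop.2 fun N => ?_
    obtain ⟨k, hk, hxk⟩ := hx N
    exact ⟨k, hk, Or.inl ((h _ _).1 (mem_ASet.2 ⟨k, hxk.1, hxk.2, rfl⟩))⟩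
  exact hmem.resolve_left fun h' => diagonal_notMem_ASet S x ((h x x).2 h')

/-- A continuous reduction of `A^S` to `A^{S'}` carries a difference `p ∈ S`, with `0 ∈ S`, to a
difference of two elements of `S'`. -/
lemma exists_mem_add_mem_of_reduction {S S' : Set ℕ} {u : Cantor → Cantor} (hu : Continuous u)
    (h : ∀ x y, (x, y) ∈ ASet S → (u x, u y) ∈ ASet S') (h0 : 0 ∈ S) {p : ℕ} (hp : p ∈ S) :
    ∃ c ∈ S', c + p ∈ S' := by
  let x : ℕ → Cantor := fun j i => decide (p ≤ i + j ∧ i < p)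
  let w : ℕ → ℕ → Cantor := fun j l => Function.update (x j) l true
  have hx : ∀ j < p, (x j, x (j + 1)) ∈ ASet S := by
    intro j hj
    refine mem_ASet.2 ⟨p - 1 - j, by simp [x]; omega, ?_, ?_⟩
    · rwa [cardOnes_eq_zero fun i hi => by simp [x]; omega]
    · ext i
      by_cases hi : i = p - 1 - j
      · subst hi
        simp [x]; omega
      · simp only [x, Function.update_of_ne hi, decide_eq_decide]
        omega
  have hw : ∀ j < p, ∀ l ≥ p, (w j l, w (j + 1) l) ∈ ASet S := by
    intro j hj l hl
    refine mem_ASet.2 ⟨p - 1 - j, ?_, ?_, ?_⟩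
    · simp only [w]
      rw [Function.update_of_ne (by omega)]
      simp [x]; omega
    · rwa [cardOnes_eq_zero fun i hi => ?_]
      simp only [w]
      rw [Function.update_of_ne (by omega)]
      simp [x]; omega
    · simp only [w]
      rw [Function.update_comm (by omega)]
      congr 1
      ext i
      by_cases hi : i = p - 1 - j
      · subst hi
        simp [x]; omega
      · simp only [x, Function.update_of_ne hi, decide_eq_decide]
        omega
  have hlim : ∀ j i, ∀ᶠ l in Filter.atTop, u (w j l) i = u (x j) i := by
    intro j i
    have ht := tendsto_pi_nhds.1 ((hu.tendsto (x j)).comp (tendsto_update (x j) true)) i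
    rw [nhds_discrete, Filter.tendsto_pure] at ht
    exact ht
  have hcard : ∀ j ≤ p, ∀ᶠ N in Filter.atTop, cardOnes (u (x j)) N = cardOnes (u (x 0)) N + j := by
    intro j
    induction j with
    | zero => simp
    | succ j ih =>
      intro hj
      obtain ⟨k, hk, -, e⟩ := mem_ASet.1 (h _ _ (hx j hj))
      filter_upwards [ih (by omega), Filter.eventually_gt_atTop k] with N hN hkN
      rw [e, cardOnes_update_true hk hkN, hN, add_assoc]
  have hdiff : ∀ j ≤ p, ∀ᶠ l in Filter.atTop, ∀ i,
      u (w j l) i = u (x j) i ↔ u (w 0 l) i = u (x 0) i := by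
    intro j
    induction j with
    | zero => simp
    | succ j ih =>
      intro hj
      obtain ⟨k, hk, -, e⟩ := mem_ASet.1 (h _ _ (hx j hj))
      filter_upwards [ih (by omega), Filter.eventually_ge_atTop p, hlim j k, hlim (j + 1) k]
        with l hl hpl h₁ h₂ i
      obtain ⟨k', hk', -, e'⟩ := mem_ASet.1 (h _ _ (hw j hj l hpl))
      have hkk : k = k' := by
        by_contra hne
        rw [e', e, Function.update_of_ne hne, h₁, hk] at h₂
        simp at h₂
      subst hkk
      rw [← hl i, e', e]
      by_cases hi : i = k
      · subst hi
        simp [h₁]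
      · simp [hi]
  obtain ⟨N, hN⟩ := Filter.eventually_atTop.1 (hcard p le_rfl)
  have hN0 : ∀ᶠ l in Filter.atTop, ∀ i ∈ Finset.range N, u (w 0 l) i = u (x 0) i :=
    (Filter.eventually_all_finset _).2 fun i _ => hlim 0 i
  obtain ⟨l, hl, hpl, hlN⟩ :=
    ((hdiff p le_rfl).and ((Filter.eventually_ge_atTop p).and hN0)).exists
  have hE0 : (x 0, w 0 l) ∈ ASet S := by
    refine mem_ASet.2 ⟨l, by simp [x], ?_, rfl⟩
    rwa [cardOnes_eq_zero fun i hi => by simp [x]]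
  have hEp : (x p, w p l) ∈ ASet S := by
    refine mem_ASet.2 ⟨l, by simp [x]; omega, ?_, rfl⟩
    have h₁ : cardOnes (x p) (0 + p) = cardOnes (x p) 0 + p :=
      cardOnes_add_of_true fun i _ hi => by simp [x]; omega
    have h₂ : cardOnes (x p) (p + (l - p)) = cardOnes (x p) p :=
      cardOnes_add_of_false fun i hi _ => by simp [x]; omega
    rw [cardOnes_zero, zero_add] at h₁
    rw [Nat.add_sub_cancel' hpl] at h₂
    rwa [h₂, h₁]
  obtain ⟨k, hk, hkS, e⟩ := mem_ASet.1 (h _ _ hE0)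
  obtain ⟨k', hk', hkS', e'⟩ := mem_ASet.1 (h _ _ hEp)
  have hkk : k' = k := by
    by_contra hne
    have := (hl k').2 (by rw [e, Function.update_of_ne hne])
    rw [e', hk'] at this
    simp at this
  subst hkk
  have hkN : N ≤ k' := by
    by_contra hlt
    have := hlN k' (Finset.mem_range.2 (by omega))
    rw [e, hk] at this
    simp at this
  exact ⟨_, hkS, hN k' hkN ▸ hkS'⟩

/-- The sequence `1^c x`. -/
def prependOnes (c : ℕ) (x : Cantor) : Cantor := fun i => if i < c then true else x (i - c)

lemma continuous_prependOnes (c : ℕ) : Continuous (prependOnes c) := by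
  refine continuous_pi fun i => ?_
  unfold prependOnes
  split_ifs
  · exact continuous_const
  · exact continuous_apply _

lemma prependOnes_add (c : ℕ) (x : Cantor) (k : ℕ) : prependOnes c x (c + k) = x k := by
  simp [prependOnes]

lemma cardOnes_prependOnes (c : ℕ) (x : Cantor) (k : ℕ) :
    cardOnes (prependOnes c x) (c + k) = c + cardOnes x k := by
  induction k with
  | zero =>
    have := cardOnes_add_of_true (x := prependOnes c x) (M := 0) (d := c) fun i _ hi => by
      simp [prependOnes, show i < c by omega]
    simpa [cardOnes_zero] using this
  | succ k ih => rw [← add_assoc, cardOnes_succ, ih, cardOnes_succ, prependOnes_add, add_assoc]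

lemma update_prependOnes (c : ℕ) (x : Cantor) (k : ℕ) (b : Bool) :
    Function.update (prependOnes c x) (c + k) b = prependOnes c (Function.update x k b) := by
  ext i
  by_cases hi : i < c
  · rw [Function.update_of_ne (by omega)]
    simp [prependOnes, hi]
  · obtain ⟨j, rfl⟩ := Nat.exists_eq_add_of_le (not_lt.1 hi)
    rw [prependOnes_add]
    by_cases hj : j = k
    · simp [hj]
    · simp [hj, prependOnes_add]

lemma prependOnes_injective (c : ℕ) : Function.Injective (prependOnes c) := fun x y h =>
  funext fun k => by rw [← prependOnes_add c x, h, prependOnes_add]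

lemma redC2_ASet_of_shift {S S' : Set ℕ} {c : ℕ} (h : ∀ m, m ∈ S ↔ c + m ∈ S') :
    RedC2 (ASet S) (ASet S') := by
  refine ⟨prependOnes c, prependOnes c, continuous_prependOnes c, continuous_prependOnes c, ?_⟩
  ext ⟨x, y⟩
  simp only [mem_preimage, mem_ASet]
  constructor
  · rintro ⟨k, hk, hkS, rfl⟩
    exact ⟨c + k, by rwa [prependOnes_add], by rwa [cardOnes_prependOnes, ← h],
      (update_prependOnes c x k true).symm⟩
  · rintro ⟨k, hk, hkS, e⟩
    have hck : c ≤ k := by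
      by_contra hlt
      simp [prependOnes, not_le.1 hlt] at hk
    obtain ⟨k, rfl⟩ := Nat.exists_eq_add_of_le hck
    rw [prependOnes_add] at hk
    rw [cardOnes_prependOnes, ← h] at hkS
    rw [update_prependOnes] at e
    exact ⟨k, hk, hkS, prependOnes_injective c e⟩

lemma exists_mem_Sbeta_ge (β : ℕ → ℕ) (m : ℕ) : ∃ s ∈ Sbeta β, m ≤ s :=
  ⟨_, ⟨m, rfl⟩, by
    simpa using Finset.sum_le_sum (s := Finset.range m) fun i _ => Nat.le_add_right 1 (β i)⟩

lemma zero_mem_Sbeta (β : ℕ → ℕ) : 0 ∈ Sbeta β := ⟨0, by simp⟩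

lemma head_add_mem_Sbeta {β : ℕ → ℕ} {m : ℕ} :
    1 + β 0 + m ∈ Sbeta β ↔ m ∈ Sbeta fun i => β (i + 1) := by
  constructor
  · rintro ⟨l, hl⟩
    cases l with
    | zero => simp at hl
    | succ l =>
      rw [Finset.sum_range_succ'] at hl
      exact ⟨l, by dsimp only; omega⟩
  · rintro ⟨l, rfl⟩
    exact ⟨l + 1, by rw [Finset.sum_range_succ', add_comm]⟩

lemma le_of_add_mem_Sbeta {β : ℕ → ℕ} {b c d : ℕ} (hβ : ∀ i, b ≤ β i) (hd : 0 < d)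
    (hc : c ∈ Sbeta β) (hcd : c + d ∈ Sbeta β) : 1 + b ≤ d := by
  obtain ⟨l, rfl⟩ := hc
  obtain ⟨l', hl'⟩ := hcd
  have hmono : Monotone fun l => ∑ i ∈ Finset.range l, (1 + β i) := fun a b hab =>
    Finset.sum_le_sum_of_subset (Finset.range_mono hab)
  have hlt : l < l' := by
    by_contra hle
    have := hmono (not_lt.1 hle)
    simp only at this
    omega
  have := hmono (Nat.succ_le_of_lt hlt)
  simp only [Nat.succ_eq_add_one, Finset.sum_range_succ] at this
  have := hβ l
  omega

theorem stmt16 :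
    (∀ n : ℕ,
      RedC2 (ASet (Sbeta (fun i => i + (n + 1)))) (ASet (Sbeta (fun i => i + n))) ∧
      ¬ RedC2 (ASet (Sbeta (fun i => i + n))) (ASet (Sbeta (fun i => i + (n + 1))))) ∧
    (∀ n : ℕ, D2Sigma01 inferInstance (ASet (Sbeta (fun i => i + n))) ∧
      ¬ PotClosed inferInstance inferInstance (ASet (Sbeta (fun i => i + n)))) := by
  refine ⟨fun n => ⟨?_, ?_⟩, fun n => ⟨d2Sigma01_ASet _,
    not_potClosed_ASet (exists_mem_Sbeta_ge _)⟩⟩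
  · refine redC2_ASet_of_shift (c := 1 + (0 + n)) fun m => ?_
    rw [head_add_mem_Sbeta (β := fun i => i + n)]
    simp only [add_assoc, add_comm 1 n]
  · rintro ⟨u, v, hu, hv, h⟩
    have h' : ∀ x y, (x, y) ∈ ASet (Sbeta fun i => i + n) ↔
        (u x, v y) ∈ ASet (Sbeta fun i => i + (n + 1)) := fun x y => by rw [h]; rfl
    obtain rfl := reduction_components_eq (exists_mem_Sbeta_ge _) hu hv h'
    obtain ⟨c, hc, hcp⟩ := exists_mem_add_mem_of_reduction hu (fun x y => (h' x y).1)
      (zero_mem_Sbeta _) (p := n + 1) ⟨1, by simp [add_comm]⟩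
    have := le_of_add_mem_Sbeta (b := n + 1) (fun i => Nat.le_add_left _ _) n.succ_pos hc hcp
    omega
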